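/- Fix γ ∈ (0,1) and R ∈ (0,γ), and let θ = (0,1). For every sufficiently small α > 0 there exist δ > 0 (the tent-width parameter of F), c > 0 and r > 0 such that for every dθ = (dθ₀, dθ₁) ∈ ℝ² with 0 < ‖dθ‖ < r which lies inside the cone of one initial point and outside the cone of the other — i.e. |z·dθ₀ + F(z)·dθ₁| ≤ α‖dθ‖₁ and |z̄·dθ₀ + F(z̄)·dθ₁| ≥ α‖dθ‖₁ for some labeling {z, z̄} = {x⋆, y⋆} — the combined cost difference is strictly positive and bounded below: (C[x⋆](θ + dθ) − C[x⋆](θ)) + (C[y⋆](θ + dθ) − C[y⋆](θ)) ≥ c·‖dθ‖₁. -/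

import Mathlib

open MeasureTheory

/-- The tent (spike) function of width `2δ` centered at `a`. -/
noncomputable def tent (a δ x : ℝ) : ℝ :=
  if x ∈ Set.Icc (a - δ) a then (x - (a - δ)) / δ
  else if x ∈ Set.Icc a (a + δ) then ((a + δ) - x) / δ
  else 0

/-- The nonlinear feature `F(x) = ω₀|x| + Σᵢ ωᵢ Λ_{aᵢ,δᵢ}(x)` with the paper's parameters
`ω₀ = −0.5, a₁ = −2, δ₁ = 0.1, ω₁ = 3, a₂ = 1.5, a₃ = 1.8, ω₂ = ω₃ = 0.2, δ₂ = δ₃ = δ`. -/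
noncomputable def Fex (δ x : ℝ) : ℝ :=
  (-0.5) * |x| + 3 * tent (-2) 0.1 x + 0.2 * tent 1.5 δ x + 0.2 * tent 1.8 δ x

/-- The closed-loop trajectory: `x₀ = z`, `x_{t+1} = u_t = θ₀ x_t + θ₁ F(x_t)`. -/
noncomputable def traj (δ : ℝ) (θ : ℝ × ℝ) (z : ℝ) : ℕ → ℝ
  | 0 => z
  | t + 1 => θ.1 * traj δ θ z t + θ.2 * Fex δ (traj δ θ z t)

/-- The discounted cost `C[z](θ) = Σ_t γᵗ (x_t² + R u_t²)` (note `u_t = x_{t+1}`). -/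
noncomputable def cost (γ R δ : ℝ) (θ : ℝ × ℝ) (z : ℝ) : ℝ :=
  ∑' t : ℕ, γ ^ t * ((traj δ θ z t) ^ 2 + R * (traj δ θ z (t + 1)) ^ 2)

/-- `x⋆ = min F⁻¹({a₂})`, the smallest preimage of `a₂ = 1.5` under `F`. -/
noncomputable def xstar (δ : ℝ) : ℝ := sInf {x : ℝ | Fex δ x = 1.5}

/-- `y⋆ = min F⁻¹({a₃})`, the smallest preimage of `a₃ = 1.8` under `F`. -/
noncomputable def ystar (δ : ℝ) : ℝ := sInf {x : ℝ | Fex δ x = 1.8}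

/-- The ℓ¹ norm `‖(a,b)‖₁ = |a| + |b|` on `ℝ²`. -/
noncomputable def l1 (dθ : ℝ × ℝ) : ℝ := |dθ.1| + |dθ.2|

lemma tent_eq_zero_of_le {a δ x : ℝ} (hδ : 0 < δ) (h : x ≤ a - δ) : tent a δ x = 0 := by
  unfold tent
  split_ifs with h1 h2
  · rw [le_antisymm h h1.1, sub_self, zero_div]
  · linarith [h2.1]
  · rfl

lemma tent_eq_zero_of_ge {a δ x : ℝ} (hδ : 0 < δ) (h : a + δ ≤ x) : tent a δ x = 0 := by
  unfold tent
  split_ifs with h1 h2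
  · linarith [h1.2]
  · rw [le_antisymm h2.2 h, sub_self, zero_div]
  · rfl

lemma tent_add_of_abs_le {a δ e : ℝ} (hδ : 0 < δ) (he : |e| ≤ δ) :
    tent a δ (a + e) = 1 - |e| / δ := by
  obtain ⟨h1, h2⟩ := abs_le.1 he
  unfold tent
  rcases le_or_gt e 0 with h | h
  · rw [if_pos ⟨by linarith, by linarith⟩, abs_of_nonpos h]
    field_simp
    ring
  · rw [if_neg (fun h' => by linarith [h'.2]), if_pos ⟨by linarith, by linarith⟩, abs_of_pos h]
    field_simp
    ring

lemma Fex_of_nonpos {δ x : ℝ} (hδ : 0 < δ) (hδ' : δ ≤ 0.1) (hx : x ≤ 0) :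
    Fex δ x = x / 2 + 3 * tent (-2) 0.1 x := by
  unfold Fex
  rw [tent_eq_zero_of_le hδ (show x ≤ 1.5 - δ by linarith),
    tent_eq_zero_of_le hδ (show x ≤ 1.8 - δ by linarith), abs_of_nonpos hx]
  ring

lemma Fex_eq_half {δ x : ℝ} (hδ : 0 < δ) (hδ' : δ ≤ 0.1) (hx : -1.9 ≤ x) (hx' : x ≤ 0) :
    Fex δ x = x / 2 := by
  rw [Fex_of_nonpos hδ hδ' hx', tent_eq_zero_of_ge (by norm_num) (by linarith)]
  ring

lemma Fex_rising {δ x : ℝ} (hδ : 0 < δ) (hδ' : δ ≤ 0.1) (hx : -2.1 ≤ x) (hx' : x ≤ -2) :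
    Fex δ x = 30.5 * x + 63 := by
  rw [Fex_of_nonpos hδ hδ' (by linarith), show x = -2 + (x + 2) by ring,
    tent_add_of_abs_le (by norm_num) (abs_le.2 ⟨by linarith, by linarith⟩),
    abs_of_nonpos (by linarith)]
  ring

lemma Fex_near_spike {δ v e : ℝ} (hδ : 0 < δ) (hδ' : δ ≤ 0.1) (hv : v = 1.5 ∨ v = 1.8)
    (he : |e| ≤ δ) : Fex δ (v + e) = -0.5 * (v + e) + 0.2 - 0.2 * (|e| / δ) := by
  obtain ⟨h1, h2⟩ := abs_le.1 he
  unfold Fex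
  rcases hv with rfl | rfl
  · rw [tent_add_of_abs_le hδ he, abs_of_nonneg (by linarith),
      tent_eq_zero_of_ge (by norm_num) (by linarith), tent_eq_zero_of_le hδ (by linarith)]
    ring
  · rw [tent_add_of_abs_le hδ he, abs_of_nonneg (by linarith),
      tent_eq_zero_of_ge (by norm_num) (by linarith), tent_eq_zero_of_ge hδ (by linarith)]
    ring

lemma sInf_Fex_preimage {δ v : ℝ} (hδ : 0 < δ) (hδ' : δ ≤ 0.1) (hv : 0 < v) (hv' : v ≤ 2) :
    sInf {x : ℝ | Fex δ x = v} = (2 * v - 126) / 61 := by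
  refine IsLeast.csInf_eq ⟨?_, fun x hx => ?_⟩
  · rw [Set.mem_ofPred_eq, Fex_rising hδ hδ' (by linarith) (by linarith)]
    ring
  · rw [Set.mem_ofPred_eq] at hx
    rcases le_total x (-2.1) with h | h
    · rw [Fex_of_nonpos hδ hδ' (by linarith),
        tent_eq_zero_of_le (by norm_num) (by linarith)] at hx
      linarith
    · rcases le_total x (-2) with h' | h'
      · rw [Fex_rising hδ hδ' h h'] at hx
        linarith
      · linarith

lemma traj_succ (δ : ℝ) (θ : ℝ × ℝ) (z : ℝ) (t : ℕ) :
    traj δ θ z (t + 1) = θ.1 * traj δ θ z t + θ.2 * Fex δ (traj δ θ z t) := rfl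

lemma traj_geometric {δ z x₂ : ℝ} {θ : ℝ × ℝ} (hδ : 0 < δ) (hδ' : δ ≤ 0.1)
    (hl : 0 ≤ θ.1 + θ.2 / 2) (hl' : θ.1 + θ.2 / 2 ≤ 1) (h2 : traj δ θ z 2 = x₂)
    (hx : -1 ≤ x₂) (hx' : x₂ ≤ 0) (t : ℕ) :
    traj δ θ z (t + 2) = (θ.1 + θ.2 / 2) ^ t * x₂ := by
  induction t with
  | zero => simpa using h2
  | succ t ih =>
    have hp : (θ.1 + θ.2 / 2) ^ t ≤ 1 := pow_le_one₀ hl hl'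
    have hp0 : 0 ≤ (θ.1 + θ.2 / 2) ^ t := pow_nonneg hl t
    rw [show t + 1 + 2 = (t + 2) + 1 by ring, traj_succ, ih,
      Fex_eq_half hδ hδ' (by nlinarith) (by nlinarith)]
    ring

lemma cost_eq {γ R δ z x₁ x₂ : ℝ} {θ : ℝ × ℝ} (hγ : γ ∈ Set.Ioo (0 : ℝ) 1)
    (hδ : 0 < δ) (hδ' : δ ≤ 0.1) (hl : 0 ≤ θ.1 + θ.2 / 2) (hl' : θ.1 + θ.2 / 2 ≤ 1)
    (h1 : traj δ θ z 1 = x₁) (h2 : traj δ θ z 2 = x₂) (hx : -1 ≤ x₂) (hx' : x₂ ≤ 0) :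
    cost γ R δ θ z =
      z ^ 2 + (R + γ) * (x₁ ^ 2 + γ * (x₂ ^ 2 * (1 - γ * (θ.1 + θ.2 / 2) ^ 2)⁻¹)) := by
  obtain ⟨hγ0, hγ1⟩ := hγ
  have hgeo := traj_geometric hδ hδ' hl hl' h2 hx hx'
  set l := θ.1 + θ.2 / 2
  have hq : γ * l ^ 2 < 1 := by nlinarith [pow_le_one₀ (n := 2) hl hl']
  have hs := (hasSum_geometric_of_lt_one (by positivity) hq).mul_left
    (γ ^ 2 * x₂ ^ 2 * (1 + R * l ^ 2))
  have hf : HasSum (fun t : ℕ => γ ^ (t + 2) *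
      ((traj δ θ z (t + 2)) ^ 2 + R * (traj δ θ z (t + 2 + 1)) ^ 2))
      (γ ^ 2 * x₂ ^ 2 * (1 + R * l ^ 2) * (1 - γ * l ^ 2)⁻¹) := by
    refine hs.congr_fun ?_
    intro t
    rw [show t + 2 + 1 = (t + 1) + 2 by ring, hgeo, hgeo]
    ring_nf
  have hF := (hasSum_nat_add_iff (f := fun t : ℕ => γ ^ t *
      ((traj δ θ z t) ^ 2 + R * (traj δ θ z (t + 1)) ^ 2)) 2).1 hf
  have h0 : traj δ θ z 0 = z := rfl
  unfold cost
  rw [hF.tsum_eq, Finset.sum_range_succ, Finset.sum_range_one]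
  simp only [h0, zero_add, h1, h2, pow_zero, pow_one, one_add_one_eq_two]
  have hne : 1 - γ * l ^ 2 ≠ 0 := by linarith
  field_simp
  ring

lemma abs_mul_le_of_mem {q s c d : ℝ} (hq : |q| ≤ s) (hc : 0 ≤ c) (hcd : c ≤ d) :
    |q * c| ≤ s * d := by
  rw [abs_mul, abs_of_nonneg hc]
  exact mul_le_mul hq hcd hc ((abs_nonneg q).trans hq)

lemma inv_discount_bounds {γ l s : ℝ} (hγ : γ ∈ Set.Ioo (0 : ℝ) 1) (hl1 : 0.4 ≤ l)
    (hl2 : l ≤ 0.6) (hls : 1 / 2 - 1.5 * s ≤ l) (hs : 0 ≤ s) :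
    1 ≤ (1 - γ * l ^ 2)⁻¹ ∧ (1 - γ * l ^ 2)⁻¹ ≤ 2 ∧
      (1 - γ * (0 + 1 / 2) ^ 2)⁻¹ - 5 * s ≤ (1 - γ * l ^ 2)⁻¹ := by
  obtain ⟨hγ0, hγ1⟩ := hγ
  have hlq : l ^ 2 ≤ 0.36 := by nlinarith
  have hA : 1 - γ * l ^ 2 ≤ 1 := by nlinarith
  have hA' : 0.64 ≤ 1 - γ * l ^ 2 := by nlinarith
  have hB' : 0.75 ≤ 1 - γ * (0 + 1 / 2) ^ 2 := by linarith
  have hid : (1 - γ * l ^ 2)⁻¹ - (1 - γ * (0 + 1 / 2) ^ 2)⁻¹ =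
      (1 - γ * l ^ 2)⁻¹ * (1 - γ * (0 + 1 / 2) ^ 2)⁻¹ * (γ * (l ^ 2 - 1 / 4)) := by
    have h1 : 1 - γ * l ^ 2 ≠ 0 := by linarith
    have h2 : 1 - γ * (0 + 1 / 2) ^ 2 ≠ 0 := by linarith
    rw [inv_sub_inv h1 h2, ← mul_inv, div_eq_inv_mul]
    ring
  have hA1 : 1 ≤ (1 - γ * l ^ 2)⁻¹ := (one_le_inv₀ (by linarith)).2 hA
  have hA2 : (1 - γ * l ^ 2)⁻¹ ≤ 2 := inv_le_of_inv_le₀ (by norm_num) (by linarith)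
  have hB0 : 0 < (1 - γ * (0 + 1 / 2) ^ 2)⁻¹ := inv_pos.2 (by linarith)
  have hB2 : (1 - γ * (0 + 1 / 2) ^ 2)⁻¹ ≤ 4 / 3 :=
    inv_le_of_inv_le₀ (by norm_num) (by linarith)
  refine ⟨hA1, hA2, ?_⟩
  have h1 : -(1.65 * s) ≤ γ * (l ^ 2 - 1 / 4) := by
    have : -(1.65 * s) ≤ l ^ 2 - 1 / 4 := by nlinarith
    rcases le_total 0 (l ^ 2 - 1 / 4) with h | h
    · nlinarith
    · nlinarith
  have h2 : (1 - γ * l ^ 2)⁻¹ * (1 - γ * (0 + 1 / 2) ^ 2)⁻¹ ≤ 2 * (4 / 3) :=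
    mul_le_mul hA2 hB2 hB0.le (by norm_num)
  have h3 : 0 ≤ (1 - γ * l ^ 2)⁻¹ * (1 - γ * (0 + 1 / 2) ^ 2)⁻¹ := by positivity
  have h4 := mul_le_mul_of_nonneg_left h1 h3
  have h5 := mul_le_mul_of_nonneg_right h2 (show 0 ≤ 1.65 * s by linarith)
  linarith

lemma quadratic_increment_bound {γ s k A B m y v e : ℝ} (hγ : γ ∈ Set.Ioo (0 : ℝ) 1)
    (hs : 0 ≤ s) (hk : 0 ≤ k) (hA1 : 1 ≤ A) (hA2 : A ≤ 2) (hAB : B - 5 * s ≤ A)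
    (hm1 : 0.55 ≤ m) (hm2 : m ≤ 0.7) (hy : m + 0.1 * k - 6 * s ≤ y) (hv0 : 0 ≤ v)
    (hv : v ≤ 1.8) (he : -(2.1 * s) ≤ e) :
    0.11 * γ * k - 30 * s ≤ (v + e) ^ 2 - v ^ 2 +
      γ * (A * (y ^ 2 - m ^ 2) + m ^ 2 * (A - B)) := by
  obtain ⟨hγ0, hγ1⟩ := hγ
  have hysq : 0.11 * k - 9 * s ≤ y ^ 2 - m ^ 2 := by
    have h1 := mul_le_mul_of_nonneg_left hy (show 0 ≤ 2 * m by linarith)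
    have h2 := mul_le_mul_of_nonneg_right hm1 hk
    have h3 := mul_le_mul_of_nonneg_right hm2 hs
    linarith [sq_nonneg (y - m)]
  have hAy : 0.11 * k - 18 * s ≤ A * (y ^ 2 - m ^ 2) := by
    have h1 := mul_le_mul_of_nonneg_left hysq (show 0 ≤ A by linarith)
    have h2 := mul_le_mul_of_nonneg_right hA1 hk
    have h3 := mul_le_mul_of_nonneg_right hA2 hs
    linarith
  have hmAB : -(2.5 * s) ≤ m ^ 2 * (A - B) := by
    have h1 : m ^ 2 ≤ 1 / 2 := by nlinarith
    have h2 := mul_le_mul_of_nonneg_left hAB (sq_nonneg m)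
    have h3 := mul_le_mul_of_nonneg_right h1 hs
    linarith
  have hve : -(7.6 * s) ≤ (v + e) ^ 2 - v ^ 2 := by
    have h1 := mul_le_mul_of_nonneg_left he hv0
    have h2 := mul_le_mul_of_nonneg_right hv hs
    linarith [sq_nonneg e]
  have h1 := mul_le_mul_of_nonneg_left (add_le_add hAy hmAB) hγ0.le
  have h2 := mul_le_mul_of_nonneg_right hγ1.le hs
  linarith

/-- The cost of a perturbed policy, from an initial state whose successor is a spike of `F`,
increases at least by the spike contribution up to a linear term. -/
lemma le_cost_sub {γ R δ v p q : ℝ} (hγ : γ ∈ Set.Ioo (0 : ℝ) 1) (hR : 0 < R)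
    (hδ : 0 < δ) (hδ' : δ ≤ 0.001) (hv : v = 1.5 ∨ v = 1.8) (hs : |p| + |q| ≤ δ / 5) :
    (R + γ) * (0.11 * γ * (|(2 * v - 126) / 61 * p + v * q| / δ) - 30 * (|p| + |q|)) ≤
      cost γ R δ (((0, 1) : ℝ × ℝ) + (p, q)) ((2 * v - 126) / 61) -
        cost γ R δ ((0, 1) : ℝ × ℝ) ((2 * v - 126) / 61) := by
  have hδ1 : δ ≤ 0.1 := by linarith
  have hv1 : 1.5 ≤ v := by rcases hv with rfl | rfl <;> norm_num
  have hv2 : v ≤ 1.8 := by rcases hv with rfl | rfl <;> norm_num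
  set z := (2 * v - 126) / 61 with hz
  have hz1 : -2.1 ≤ z := by linarith
  have hz2 : z ≤ -2 := by linarith
  have hFz : Fex δ z = v := by
    rw [Fex_rising hδ hδ1 hz1 hz2, hz]
    ring
  have hFv : Fex δ v = -0.5 * v + 0.2 := by
    simpa using Fex_near_spike hδ hδ1 hv (e := 0) (by simpa using hδ.le)
  set e := z * p + v * q with he
  set s := |p| + |q| with hs_def
  have hp := abs_nonneg p
  have hq := abs_nonneg q
  have hps : |p| ≤ s := by linarith
  have hqs : |q| ≤ s := by linarith
  have hes : |e| ≤ 2.1 * s := by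
    calc |e| ≤ |z * p| + |v * q| := abs_add_le _ _
      _ = |z| * |p| + |v| * |q| := by rw [abs_mul, abs_mul]
      _ ≤ 2.1 * |p| + 2.1 * |q| := by
        gcongr
        · exact abs_le.2 ⟨hz1, by linarith⟩
        · exact abs_le.2 ⟨by linarith, by linarith⟩
      _ = 2.1 * s := by ring
  have heδ : |e| ≤ δ := by linarith
  set k := |e| / δ with hk
  have hk0 : 0 ≤ k := by positivity
  have hk1 : k ≤ 1 := (div_le_one hδ).2 heδ
  obtain ⟨e1, e2⟩ := abs_le.1 hes
  obtain ⟨p1, p2⟩ := abs_le.1 hps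
  obtain ⟨q1, q2⟩ := abs_le.1 hqs
  have hs0 : 0 ≤ s := by linarith
  have hs1 : s ≤ 0.0002 := by linarith
  set m := 0.5 * v - 0.2 with hm
  set y := (1 + q) * (m + 0.5 * e + 0.2 * k) - p * (v + e) with hy
  have hqm := abs_le.1 (abs_mul_le_of_mem hqs
    (show 0 ≤ m + 0.5 * e + 0.2 * k by linarith) (show _ ≤ 0.92 by linarith))
  have hpv := abs_le.1 (abs_mul_le_of_mem hps
    (show 0 ≤ v + e by linarith) (show _ ≤ 1.9 by linarith))
  have hy1 : m + 0.1 * k - 6 * s ≤ y := by linarith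
  have hy2 : y ≤ 1 := by linarith
  have hC0 : cost γ R δ ((0, 1) : ℝ × ℝ) z = z ^ 2 + (R + γ) *
      (v ^ 2 + γ * ((-m) ^ 2 * (1 - γ * (0 + 1 / 2) ^ 2)⁻¹)) := by
    refine cost_eq (θ := ((0, 1) : ℝ × ℝ)) hγ hδ hδ1 (by norm_num) (by norm_num) ?_ ?_
      (by linarith) (by linarith)
    · simp [traj, hFz]
    · simp only [traj, hFz, zero_mul, one_mul, zero_add, hFv]
      ring
  have hC1 : cost γ R δ (((0, 1) : ℝ × ℝ) + (p, q)) z = z ^ 2 + (R + γ) *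
      ((v + e) ^ 2 + γ * ((-y) ^ 2 * (1 - γ * ((0 + p) + (1 + q) / 2) ^ 2)⁻¹)) := by
    have h1 : (0 + p) * z + (1 + q) * v = v + e := by rw [he]; ring
    refine cost_eq (θ := ((0, 1) : ℝ × ℝ) + (p, q)) hγ hδ hδ1 ?_ ?_ ?_ ?_
      (by linarith) (by linarith)
    · change 0 ≤ (0 + p) + (1 + q) / 2
      linarith
    · change (0 + p) + (1 + q) / 2 ≤ 1
      linarith
    · simp only [traj, hFz, Prod.mk_add_mk, h1]
    · simp only [traj, hFz, Prod.mk_add_mk, h1, Fex_near_spike hδ hδ1 hv heδ]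
      rw [hy, hm, hk]
      ring
  obtain ⟨hγ0, hγ1⟩ := hγ
  rw [hC0, hC1]
  set l := (0 + p) + (1 + q) / 2 with hl
  have hl1 : 0.4 ≤ l := by linarith
  have hl2 : l ≤ 0.6 := by linarith
  obtain ⟨hA1, hA2, hAB⟩ := inv_discount_bounds ⟨hγ0, hγ1⟩ hl1 hl2
    (show 1 / 2 - 1.5 * s ≤ l by linarith) hs0
  have hmain := quadratic_increment_bound ⟨hγ0, hγ1⟩ hs0 hk0 hA1 hA2 hAB
    (show 0.55 ≤ m by linarith) (show m ≤ 0.7 by linarith) hy1 (by linarith) hv2 e1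
  have hG : 0 < R + γ := by linarith
  calc (R + γ) * (0.11 * γ * k - 30 * s) ≤ _ := mul_le_mul_of_nonneg_left hmain hG.le
    _ = _ := by ring

/-- If a small perturbation `dθ` of `θ = (0,1)` lies inside the cone of one of the two atomic
initial states `x⋆, y⋆` and outside the cone of the other, the combined cost difference of the
two trajectories is still strictly positive and bounded below by a multiple of `‖dθ‖₁`,
for every sufficiently small cone aperture `α > 0`. -/
theorem cost_increase_one_cone (γ R : ℝ)
    (hγ : γ ∈ Set.Ioo (0 : ℝ) 1) (hR : R ∈ Set.Ioo (0 : ℝ) γ) :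
    ∃ α₀ > (0 : ℝ), ∀ α : ℝ, 0 < α → α < α₀ →
      ∃ δ > (0 : ℝ), ∃ c > (0 : ℝ), ∃ r > (0 : ℝ),
        ∀ dθ : ℝ × ℝ, dθ ≠ 0 → ‖dθ‖ < r →
          ((|xstar δ * dθ.1 + Fex δ (xstar δ) * dθ.2| ≤ α * l1 dθ ∧
              α * l1 dθ ≤ |ystar δ * dθ.1 + Fex δ (ystar δ) * dθ.2|) ∨
           (|ystar δ * dθ.1 + Fex δ (ystar δ) * dθ.2| ≤ α * l1 dθ ∧
              α * l1 dθ ≤ |xstar δ * dθ.1 + Fex δ (xstar δ) * dθ.2|)) →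
          c * l1 dθ ≤
            (cost γ R δ (((0, 1) : ℝ × ℝ) + dθ) (xstar δ) -
              cost γ R δ ((0, 1) : ℝ × ℝ) (xstar δ)) +
            (cost γ R δ (((0, 1) : ℝ × ℝ) + dθ) (ystar δ) -
              cost γ R δ ((0, 1) : ℝ × ℝ) (ystar δ)) := by
  obtain ⟨hγ0, hγ1⟩ := hγ
  refine ⟨1, one_pos, fun α hα hα1 => ?_⟩
  have hG : 0 < R + γ := by linarith [hR.1]
  set δ := γ * α / 1000 with hδdef
  have hδ : 0 < δ := by positivity
  have hδ' : δ ≤ 0.001 := by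
    have : γ * α ≤ 1 := mul_le_one₀ hγ1.le hα.le hα1.le
    linarith
  have hx : xstar δ = (2 * 1.5 - 126) / 61 :=
    sInf_Fex_preimage hδ (by linarith) (by norm_num) (by norm_num)
  have hy : ystar δ = (2 * 1.8 - 126) / 61 :=
    sInf_Fex_preimage hδ (by linarith) (by norm_num) (by norm_num)
  have hFx : Fex δ (xstar δ) = 1.5 := by
    rw [hx, Fex_rising hδ (by linarith) (by norm_num) (by norm_num)]
    norm_num
  have hFy : Fex δ (ystar δ) = 1.8 := by
    rw [hy, Fex_rising hδ (by linarith) (by norm_num) (by norm_num)]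
    norm_num
  refine ⟨δ, hδ, 50 * (R + γ), by positivity, δ / 10, by positivity, ?_⟩
  rintro ⟨p, q⟩ - hr hcone
  have hpn : |p| ≤ ‖(p, q)‖ := norm_fst_le (p, q)
  have hqn : |q| ≤ ‖(p, q)‖ := norm_snd_le (p, q)
  have hs : |p| + |q| ≤ δ / 5 := by linarith
  have hX := le_cost_sub ⟨hγ0, hγ1⟩ hR.1 hδ hδ' (Or.inl rfl) hs
  have hY := le_cost_sub ⟨hγ0, hγ1⟩ hR.1 hδ hδ' (Or.inr rfl) hs
  rw [← hx] at hX
  rw [← hy] at hY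
  rw [hFx, hFy] at hcone
  simp only [l1] at hcone ⊢
  have hspike (w : ℝ) (hw : α * (|p| + |q|) ≤ |w|) :
      110 * (|p| + |q|) ≤ 0.11 * γ * (|w| / δ) := by
    have h1 : α * (|p| + |q|) / δ ≤ |w| / δ := by gcongr
    have h2 : γ * (α * (|p| + |q|) / δ) = 1000 * (|p| + |q|) := by
      rw [hδdef]
      field_simp
    nlinarith
  have hnonneg (w : ℝ) : 0 ≤ 0.11 * γ * (|w| / δ) := by positivity
  refine le_trans ?_ (add_le_add hX hY)
  rw [← mul_add, mul_comm 50, mul_assoc]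
  refine mul_le_mul_of_nonneg_left ?_ hG.le
  rcases hcone with ⟨-, h⟩ | ⟨-, h⟩
  · linarith [hspike _ h, hnonneg (xstar δ * p + 1.5 * q)]
  · linarith [hspike _ h, hnonneg (ystar δ * p + 1.8 * q)]
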